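/- arXiv:1603.00204 — 2 statements merged into one kernel-verified Lean document; each statement's English description precedes it below -/
import Mathlib

section
/- Let N ≥ 1, let Ω ⊆ ℝ^N be a nonempty bounded open set, let λ > 0, and let u : ℝ^N → ℝ be continuously differentiable on an open neighborhood of the closure of Ω, three times continuously differentiable on Ω, and satisfy Δu(x) = -1 for all x ∈ Ω and ‖∇u(x)‖ = λ for all x in the topological boundary ∂Ω of Ω. Then ‖∇u(x)‖ < λ for every x ∈ Ω. -/
noncomputable section

/-- The `(i,j)` entry of the Hessian of `u : ℝ^N → ℝ` at `x`, i.e. `∂²u/∂x_i∂x_j (x)`. -/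
def hessEntry {N : ℕ} (u : EuclideanSpace ℝ (Fin N) → ℝ) (x : EuclideanSpace ℝ (Fin N))
    (i j : Fin N) : ℝ :=
  fderiv ℝ (fun y => fderiv ℝ u y (EuclideanSpace.single j 1)) x (EuclideanSpace.single i 1)

/-- The Laplacian of `u : ℝ^N → ℝ` at `x`: the trace of the Hessian of `u` at `x`. -/
def lap {N : ℕ} (u : EuclideanSpace ℝ (Fin N) → ℝ) (x : EuclideanSpace ℝ (Fin N)) : ℝ :=
  ∑ i, hessEntry u x i i

open Filter Topology

section DirectionalDerivative

variable {E : Type*} [NormedAddCommGroup E] [NormedSpace ℝ E]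

/-- The derivative of `f` in the direction `v`, as a function of the base point. -/
def dirDeriv (v : E) (f : E → ℝ) (x : E) : ℝ := fderiv ℝ f x v

theorem ContDiffAt.dirDeriv {f : E → ℝ} {x : E} {m n : WithTop ℕ∞} (hf : ContDiffAt ℝ n f x)
    (hmn : m + 1 ≤ n) (v : E) : ContDiffAt ℝ m (dirDeriv v f) x :=
  (hf.fderiv_right hmn).clm_apply contDiffAt_const

theorem Filter.EventuallyEq.dirDeriv {f g : E → ℝ} {x : E} (h : f =ᶠ[𝓝 x] g) (v : E) :
    dirDeriv v f =ᶠ[𝓝 x] dirDeriv v g :=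
  (h.fderiv (𝕜 := ℝ)).mono fun y hy => by simp only [_root_.dirDeriv, hy]

theorem dirDeriv_comm {f : E → ℝ} {x : E} (hf : ContDiffAt ℝ 2 f x) (v w : E) :
    dirDeriv v (dirDeriv w f) x = dirDeriv w (dirDeriv v f) x := by
  have hd : DifferentiableAt ℝ (fderiv ℝ f) x :=
    (hf.fderiv_right (m := 1) (by norm_num [one_add_one_eq_two])).differentiableAt (by norm_num)
  have key (a b : E) : dirDeriv a (dirDeriv b f) x = fderiv ℝ (fderiv ℝ f) x a b := by
    have := (hd.hasFDerivAt.clm_apply (hasFDerivAt_const b x)).fderiv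
    change fderiv ℝ (fun y => fderiv ℝ f y b) x a = _
    rw [this]
    simp
  rw [key, key]
  exact (hf.isSymmSndFDerivAt (by simp)).eq v w

theorem dirDeriv_dirDeriv_comm {f : E → ℝ} {x : E} (hf : ContDiffAt ℝ 3 f x) (v w : E) :
    dirDeriv v (dirDeriv v (dirDeriv w f)) x = dirDeriv w (dirDeriv v (dirDeriv v f)) x := by
  have hcomm : dirDeriv v (dirDeriv w f) =ᶠ[𝓝 x] dirDeriv w (dirDeriv v f) := by
    filter_upwards [hf.eventually (by simp)] with y hy
    exact dirDeriv_comm (hy.of_le (by norm_num)) v w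
  rw [(hcomm.dirDeriv v).eq_of_nhds,
    dirDeriv_comm (hf.dirDeriv (by norm_num [two_add_one_eq_three]) v)]

theorem dirDeriv_sum {ι : Type*} {s : Finset ι} {f : ι → E → ℝ} {x : E}
    (hf : ∀ i ∈ s, DifferentiableAt ℝ (f i) x) (v : E) :
    dirDeriv v (fun y => ∑ i ∈ s, f i y) x = ∑ i ∈ s, dirDeriv v (f i) x := by
  simp [dirDeriv, fderiv_fun_sum hf]

theorem dirDeriv_sq {f : E → ℝ} {x : E} (hf : DifferentiableAt ℝ f x) (v : E) :
    dirDeriv v (fun y => f y ^ 2) x = 2 * (f x * dirDeriv v f x) := by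
  simp [dirDeriv, fderiv_fun_pow 2 hf, mul_assoc]

theorem dirDeriv_dirDeriv_sq {f : E → ℝ} {x : E} (hf : ContDiffAt ℝ 2 f x) (v : E) :
    dirDeriv v (dirDeriv v (fun y => f y ^ 2)) x =
      2 * (dirDeriv v f x ^ 2 + f x * dirDeriv v (dirDeriv v f) x) := by
  have hfirst : dirDeriv v (fun y => f y ^ 2) =ᶠ[𝓝 x] fun y => 2 * (f y * dirDeriv v f y) := by
    filter_upwards [hf.eventually (by simp)] with y hy
    exact dirDeriv_sq (hy.differentiableAt (by norm_num)) v
  have hf' : DifferentiableAt ℝ f x := hf.differentiableAt (by norm_num)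
  have hdf : DifferentiableAt ℝ (dirDeriv v f) x :=
    (hf.dirDeriv (m := 1) (by norm_num [one_add_one_eq_two]) v).differentiableAt (by norm_num)
  rw [(hfirst.dirDeriv v).eq_of_nhds]
  change fderiv ℝ (fun y => 2 * (f y * dirDeriv v f y)) x v = _
  rw [fderiv_const_mul (hf'.fun_mul hdf), fderiv_fun_mul hf' hdf]
  simp [dirDeriv]
  ring

theorem IsLocalMax.deriv_deriv_nonpos {g : ℝ → ℝ} {t : ℝ} (h : IsLocalMax g t)
    (hg : ContinuousAt g t) : deriv (deriv g) t ≤ 0 := by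
  by_contra! hpos
  have hmin : IsLocalMin g t := isLocalMin_of_deriv_deriv_pos hpos h.deriv_eq_zero hg
  have hconst : g =ᶠ[𝓝 t] fun _ => g t := by
    filter_upwards [h, hmin] with s hs hs' using le_antisymm hs hs'
  have : deriv (deriv g) t = 0 := by simp [hconst.deriv.deriv_eq]
  exact hpos.ne' this

theorem IsLocalMax.dirDeriv_dirDeriv_nonpos {f : E → ℝ} {x : E} (h : IsLocalMax f x)
    (hf : ContDiffAt ℝ 2 f x) (v : E) : dirDeriv v (dirDeriv v f) x ≤ 0 := by
  let line : ℝ → E := fun t => x + t • v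
  have hline (t : ℝ) : HasDerivAt line v t := by
    simpa only [one_smul] using ((hasDerivAt_id' t).smul_const v).const_add x
  have hline0 : line 0 = x := by simp [line]
  have htendsto : Tendsto line (𝓝 0) (𝓝 x) := by
    simpa [hline0] using (hline 0).continuousAt.tendsto
  have hderiv {g : E → ℝ} {t : ℝ} (hg : DifferentiableAt ℝ g (line t)) :
      deriv (g ∘ line) t = dirDeriv v g (line t) :=
    (hg.hasFDerivAt.comp_hasDerivAt t (hline t)).deriv
  have hfirst : deriv (f ∘ line) =ᶠ[𝓝 0] dirDeriv v f ∘ line := by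
    filter_upwards [htendsto.eventually (hf.eventually (by simp))] with t ht
    exact hderiv (ht.differentiableAt (by norm_num))
  have hsecond : deriv (deriv (f ∘ line)) 0 = dirDeriv v (dirDeriv v f) x := by
    rw [hfirst.deriv_eq, hderiv, hline0]
    rw [hline0]
    exact (hf.dirDeriv (m := 1) (by norm_num [one_add_one_eq_two]) v).differentiableAt
      (by norm_num)
  rw [← hsecond]
  refine IsLocalMax.deriv_deriv_nonpos ?_ ?_
  · filter_upwards [htendsto.eventually h] with t ht
    simpa [hline0] using ht
  · exact ContinuousAt.comp (by rw [hline0]; exact hf.continuousAt) (hline 0).continuousAt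

end DirectionalDerivative

theorem norm_gradient_sq_eq_sum {N : ℕ} (u : EuclideanSpace ℝ (Fin N) → ℝ)
    (x : EuclideanSpace ℝ (Fin N)) :
    ‖gradient u x‖ ^ 2 = ∑ j, dirDeriv (EuclideanSpace.single j 1) u x ^ 2 := by
  rw [EuclideanSpace.real_norm_sq_eq]
  refine Finset.sum_congr rfl fun j _ => ?_
  rw [dirDeriv, ← inner_gradient_left, EuclideanSpace.inner_single_right]
  simp

/-- Bochner formula: the Laplacian of `‖∇u‖²` is twice the squared norm of the Hessian when
`Δu` is locally constant. -/
theorem lap_norm_gradient_sq {N : ℕ} {u : EuclideanSpace ℝ (Fin N) → ℝ} {x : EuclideanSpace ℝ (Fin N)}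
    (hu : ContDiffAt ℝ 3 u x) {c : ℝ} (hlap : lap u =ᶠ[𝓝 x] fun _ => c) :
    lap (fun y => ‖gradient u y‖ ^ 2) x = 2 * ∑ i, ∑ j, hessEntry u x i j ^ 2 := by
  let e (i : Fin N) : EuclideanSpace ℝ (Fin N) := EuclideanSpace.single i 1
  let P (j : Fin N) (y : EuclideanSpace ℝ (Fin N)) : ℝ := dirDeriv (e j) u y ^ 2
  have hv (j : Fin N) : ContDiffAt ℝ 2 (dirDeriv (e j) u) x :=
    hu.dirDeriv (by norm_num [two_add_one_eq_three]) _
  have hP (j : Fin N) : ContDiffAt ℝ 2 (P j) x := (hv j).pow 2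
  have hsum (i : Fin N) : dirDeriv (e i) (dirDeriv (e i) fun y => ∑ j, P j y) x =
      ∑ j, dirDeriv (e i) (dirDeriv (e i) (P j)) x := by
    have hfirst : dirDeriv (e i) (fun y => ∑ j, P j y) =ᶠ[𝓝 x]
        fun y => ∑ j, dirDeriv (e i) (P j) y := by
      filter_upwards [eventually_all.2 fun j => (hP j).eventually (by simp)] with y hy
      exact dirDeriv_sum (fun j _ => (hy j).differentiableAt (by norm_num)) _
    rw [(hfirst.dirDeriv _).eq_of_nhds]
    exact dirDeriv_sum (fun j _ => ((hP j).dirDeriv (m := 1)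
      (by norm_num [one_add_one_eq_two]) _).differentiableAt (by norm_num)) _
  have hharm (j : Fin N) : ∑ i, dirDeriv (e i) (dirDeriv (e i) (dirDeriv (e j) u)) x = 0 := by
    have hdiff (i : Fin N) : DifferentiableAt ℝ (dirDeriv (e i) (dirDeriv (e i) u)) x :=
      ((hv i).dirDeriv (m := 1) (by norm_num [one_add_one_eq_two]) _).differentiableAt
        (by norm_num)
    simp_rw [dirDeriv_dirDeriv_comm hu]
    rw [← dirDeriv_sum fun i _ => hdiff i]
    change dirDeriv (e j) (lap u) x = 0
    rw [(hlap.dirDeriv _).eq_of_nhds]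
    simp [dirDeriv]
  have hgrad : (fun y => ‖gradient u y‖ ^ 2) = fun y => ∑ j, P j y :=
    funext (norm_gradient_sq_eq_sum u)
  rw [hgrad]
  change ∑ i, dirDeriv (e i) (dirDeriv (e i) fun y => ∑ j, P j y) x =
    2 * ∑ i, ∑ j, dirDeriv (e i) (dirDeriv (e j) u) x ^ 2
  simp_rw [hsum, P, fun i j => dirDeriv_dirDeriv_sq (hv j) (e i), mul_add, Finset.sum_add_distrib,
    ← Finset.mul_sum]
  rw [add_eq_left, Finset.sum_comm]
  simp [← Finset.mul_sum, hharm]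

theorem ContDiffAt.norm_gradient_sq {N : ℕ} {u : EuclideanSpace ℝ (Fin N) → ℝ}
    {x : EuclideanSpace ℝ (Fin N)} {m n : WithTop ℕ∞} (hu : ContDiffAt ℝ n u x)
    (hmn : m + 1 ≤ n) : ContDiffAt ℝ m (fun y => ‖gradient u y‖ ^ 2) x := by
  simp_rw [norm_gradient_sq_eq_sum]
  exact ContDiffAt.sum fun j _ => (hu.dirDeriv hmn _).pow 2

theorem not_isLocalMax_norm_gradient_sq {N : ℕ} {u : EuclideanSpace ℝ (Fin N) → ℝ}
    {x : EuclideanSpace ℝ (Fin N)} (hu : ContDiffAt ℝ 3 u x) {c : ℝ} (hc : c ≠ 0)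
    (hlap : lap u =ᶠ[𝓝 x] fun _ => c) : ¬ IsLocalMax (fun y => ‖gradient u y‖ ^ 2) x := by
  intro hmax
  have hle : lap (fun y => ‖gradient u y‖ ^ 2) x ≤ 0 := Finset.sum_nonpos fun i _ =>
    hmax.dirDeriv_dirDeriv_nonpos (hu.norm_gradient_sq (by norm_num [two_add_one_eq_three])) _
  rw [lap_norm_gradient_sq hu hlap] at hle
  have hnonneg (i : Fin N) : 0 ≤ ∑ j, hessEntry u x i j ^ 2 :=
    Finset.sum_nonneg fun j _ => sq_nonneg _
  have hzero : ∑ i, ∑ j, hessEntry u x i j ^ 2 = 0 :=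
    le_antisymm (by linarith) (Finset.sum_nonneg fun i _ => hnonneg i)
  have hdiag (i : Fin N) : hessEntry u x i i = 0 := by
    have hi := (Finset.sum_eq_zero_iff_of_nonneg fun i _ => hnonneg i).1 hzero i
      (Finset.mem_univ i)
    exact pow_eq_zero_iff two_ne_zero |>.1 <|
      (Finset.sum_eq_zero_iff_of_nonneg fun j _ => sq_nonneg _).1 hi i (Finset.mem_univ i)
  exact hc (by rw [← hlap.eq_of_nhds, lap]; simp [hdiag])

/-- Strict gradient bound: if `Ω ⊆ ℝ^N` is a nonempty bounded open set, `λ > 0`, and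
`u` is `C¹` on an open neighborhood of `closure Ω`, `C³` on `Ω`, with `Δu = -1` in `Ω`
and `‖∇u‖ = λ` on `∂Ω`, then `‖∇u‖ < λ` everywhere in `Ω`. -/
theorem norm_gradient_lt_of_torsion {N : ℕ} (hN : 1 ≤ N)
    {Ω : Set (EuclideanSpace ℝ (Fin N))} (hne : Ω.Nonempty) (hΩ : IsOpen Ω)
    (hbd : Bornology.IsBounded Ω) {lam : ℝ} (hlam : 0 < lam)
    {u : EuclideanSpace ℝ (Fin N) → ℝ}
    (hu1 : ∃ V : Set (EuclideanSpace ℝ (Fin N)),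
      IsOpen V ∧ closure Ω ⊆ V ∧ ContDiffOn ℝ 1 u V)
    (hu3 : ContDiffOn ℝ 3 u Ω)
    (hΔu : ∀ x ∈ Ω, lap u x = -1)
    (hbdry : ∀ x ∈ frontier Ω, ‖gradient u x‖ = lam) :
    ∀ x ∈ Ω, ‖gradient u x‖ < lam := by
  obtain ⟨V, hVo, hV, hu1⟩ := hu1
  let P : EuclideanSpace ℝ (Fin N) → ℝ := fun y => ‖gradient u y‖ ^ 2
  have hcont : ContinuousOn P (closure Ω) := fun y hy =>
    ((hu1.contDiffAt (hVo.mem_nhds (hV hy))).norm_gradient_sq (m := 0)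
      (by norm_num)).continuousAt.continuousWithinAt
  have hmax {y : EuclideanSpace ℝ (Fin N)} (hy : y ∈ Ω) : ¬ IsMaxOn P (closure Ω) y := by
    intro h
    refine not_isLocalMax_norm_gradient_sq (hu3.contDiffAt (hΩ.mem_nhds hy))
      (neg_ne_zero.2 one_ne_zero) ?_
      (h.isLocalMax (mem_of_superset (hΩ.mem_nhds hy) subset_closure))
    filter_upwards [hΩ.mem_nhds hy] with z hz using hΔu z hz
  obtain ⟨z, hz, hzmax⟩ := hbd.isCompact_closure.exists_isMaxOn hne.closure hcont
  have hzfr : z ∈ frontier Ω := by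
    rw [hΩ.frontier_eq]
    exact ⟨hz, fun hzΩ => hmax hzΩ hzmax⟩
  have hPz : P z = lam ^ 2 := by simp only [P, hbdry z hzfr]
  intro x hx
  by_contra! hle
  refine hmax hx fun y hy => le_trans (b := P z) (hzmax hy) ?_
  rw [hPz]
  exact pow_le_pow_left₀ hlam.le hle 2

end
end

section
/- (Model case of Theorem 0: balls are uniquely self-Cheeger with Cheeger constant N/ε.) Let N ≥ 2, let ε > 0, and let B_ε ⊂ ℝ^N be the open ball of radius ε centered at the origin. Then for every measurable set A ⊆ B_ε with vol(A) > 0 one has P(A)/vol(A) ≥ N/ε; equality P(A) = (N/ε)·vol(A) holds if and only if vol(B_ε \ A) = 0. In particular the Cheeger constant h(B_ε) := inf { P(A)/vol(A) : A ⊆ B_ε measurable, vol(A) > 0, P(A) < ∞ } equals N/ε and is attained (uniquely, up to null sets) by A = B_ε. -/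
open MeasureTheory
open scoped ENNReal

noncomputable section

/-- The divergence of a vector field `ξ : ℝ^N → ℝ^N` at `x`: the trace of its derivative. -/
def diverg {N : ℕ} (ξ : EuclideanSpace ℝ (Fin N) → EuclideanSpace ℝ (Fin N))
    (x : EuclideanSpace ℝ (Fin N)) : ℝ :=
  ∑ i, fderiv ℝ ξ x (EuclideanSpace.single i 1) i

/-- The variational perimeter of a set `A ⊆ ℝ^N`:
`P(A) = sup { ∫_A div ξ : ξ ∈ C¹(ℝ^N, ℝ^N), ‖ξ‖ ≤ 1 }`. -/
def perimeter {N : ℕ} (A : Set (EuclideanSpace ℝ (Fin N))) : ℝ≥0∞ :=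
  ⨆ ξ : {ξ : EuclideanSpace ℝ (Fin N) → EuclideanSpace ℝ (Fin N) //
      ContDiff ℝ 1 ξ ∧ ∀ x, ‖ξ x‖ ≤ 1},
    ENNReal.ofReal (∫ x in A, diverg ξ.1 x)

/-- The Cheeger constant of `Ω ⊆ ℝ^N`:
`h(Ω) = inf { P(A)/vol(A) : A ⊆ Ω measurable, vol(A) > 0, P(A) < ∞ }`. -/
def cheegerConstant {N : ℕ} (Ω : Set (EuclideanSpace ℝ (Fin N))) : ℝ≥0∞ :=
  ⨅ A ∈ {A : Set (EuclideanSpace ℝ (Fin N)) |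
      A ⊆ Ω ∧ MeasurableSet A ∧ 0 < volume A ∧ perimeter A < ⊤},
    perimeter A / volume A

lemma diverg_continuous {N : ℕ} {ξ : EuclideanSpace ℝ (Fin N) → EuclideanSpace ℝ (Fin N)}
    (hξ : ContDiff ℝ 1 ξ) : Continuous (diverg ξ) := by
  unfold diverg
  refine continuous_finsetSum _ fun i _ => ?_
  have h := (hξ.continuous_fderiv one_ne_zero).clm_apply
    (continuous_const (y := EuclideanSpace.single i (1 : ℝ)))
  exact (EuclideanSpace.proj (𝕜 := ℝ) i).continuous.comp h

lemma diverg_congr {N : ℕ} {ξ η : EuclideanSpace ℝ (Fin N) → EuclideanSpace ℝ (Fin N)}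
    {x : EuclideanSpace ℝ (Fin N)} (h : ξ =ᶠ[nhds x] η) : diverg ξ x = diverg η x := by
  simp only [diverg, h.fderiv_eq]

lemma diverg_add {N : ℕ} {ξ η : EuclideanSpace ℝ (Fin N) → EuclideanSpace ℝ (Fin N)}
    {x : EuclideanSpace ℝ (Fin N)} (hξ : DifferentiableAt ℝ ξ x) (hη : DifferentiableAt ℝ η x) :
    diverg (fun y => ξ y + η y) x = diverg ξ x + diverg η x := by
  simp [diverg, fderiv_fun_add hξ hη, Finset.sum_add_distrib]

lemma diverg_const_smul_id {N : ℕ} (c : ℝ) (x : EuclideanSpace ℝ (Fin N)) :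
    diverg (fun y : EuclideanSpace ℝ (Fin N) => c • y) x = N * c := by
  have : fderiv ℝ (fun y : EuclideanSpace ℝ (Fin N) => c • y) x
      = c • ContinuousLinearMap.id ℝ _ := by
    exact ((hasFDerivAt_id x).const_smul c).fderiv
  simp [diverg, this]

lemma sum_apply_single_mul {N : ℕ} (L : EuclideanSpace ℝ (Fin N) →L[ℝ] ℝ)
    (v : EuclideanSpace ℝ (Fin N)) :
    ∑ i, L (EuclideanSpace.single i 1) * v i = L v := by
  conv_rhs => rw [← (EuclideanSpace.basisFun (Fin N) ℝ).sum_repr v]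
  simp [map_sum, mul_comm]

lemma diverg_smul_const {N : ℕ} {ρ : EuclideanSpace ℝ (Fin N) → ℝ}
    {x : EuclideanSpace ℝ (Fin N)} (hρ : DifferentiableAt ℝ ρ x) (v : EuclideanSpace ℝ (Fin N)) :
    diverg (fun y => ρ y • v) x = fderiv ℝ ρ x v := by
  rw [diverg, fderiv_smul_const hρ, ← sum_apply_single_mul]
  simp

lemma integrableOn_diverg {N : ℕ} {ξ : EuclideanSpace ℝ (Fin N) → EuclideanSpace ℝ (Fin N)}
    (hξ : ContDiff ℝ 1 ξ) {ε : ℝ} {A : Set (EuclideanSpace ℝ (Fin N))}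
    (hA : A ⊆ Metric.ball 0 ε) : IntegrableOn (diverg ξ) A :=
  ((diverg_continuous hξ).continuousOn.integrableOn_compact
    (isCompact_closedBall (0 : EuclideanSpace ℝ (Fin N)) ε)).mono_set
    (hA.trans Metric.ball_subset_closedBall)

/-- Integration by parts against a compactly supported cutoff. -/
lemma integral_mul_diverg {N : ℕ} {φ : EuclideanSpace ℝ (Fin N) → ℝ}
    {ξ : EuclideanSpace ℝ (Fin N) → EuclideanSpace ℝ (Fin N)}
    (hφ : ContDiff ℝ 1 φ) (hc : HasCompactSupport φ) (hξ : ContDiff ℝ 1 ξ) :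
    ∫ x, φ x * diverg ξ x = - ∫ x, fderiv ℝ φ x (ξ x) := by
  have hξi : ∀ i, ContDiff ℝ 1 (fun x => ξ x i) := fun i =>
    (EuclideanSpace.proj (𝕜 := ℝ) i).contDiff.comp hξ
  have hfi : ∀ i x v, fderiv ℝ (fun x => ξ x i) x v = fderiv ℝ ξ x v i := by
    intro i x v
    have := ((EuclideanSpace.proj (𝕜 := ℝ) i).hasFDerivAt.comp x
      (hξ.differentiable one_ne_zero x).hasFDerivAt).fderiv
    exact congrArg (fun L => L v) this
  have hd : ∀ v, Continuous fun x => fderiv ℝ φ x v := fun v =>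
    (hφ.continuous_fderiv one_ne_zero).clm_apply continuous_const
  have hdc : ∀ v, HasCompactSupport fun x => fderiv ℝ φ x v := fun v => hc.fderiv_apply ℝ v
  have h1 : ∀ i, Integrable fun x =>
      fderiv ℝ φ x (EuclideanSpace.single i 1) * ξ x i := fun i =>
    ((hd _).mul (hξi i).continuous).integrable_of_hasCompactSupport (hdc _).mul_right
  have h2 : ∀ i, Integrable fun x =>
      φ x * fderiv ℝ (fun x => ξ x i) x (EuclideanSpace.single i 1) := fun i =>
    (hφ.continuous.mul (((hξi i).continuous_fderiv one_ne_zero).clm_apply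
      continuous_const)).integrable_of_hasCompactSupport hc.mul_right
  have h3 : ∀ i, Integrable fun x => φ x * ξ x i := fun i =>
    (hφ.continuous.mul (hξi i).continuous).integrable_of_hasCompactSupport hc.mul_right
  calc ∫ x, φ x * diverg ξ x
      = ∫ x, ∑ i, φ x * fderiv ℝ (fun x => ξ x i) x (EuclideanSpace.single i 1) := by
        simp only [diverg, hfi, Finset.mul_sum]
    _ = ∑ i, - ∫ x, fderiv ℝ φ x (EuclideanSpace.single i 1) * ξ x i := by
        rw [integral_finsetSum _ fun i _ => h2 i]
        refine Finset.sum_congr rfl fun i _ => ?_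
        exact integral_mul_fderiv_eq_neg_fderiv_mul_of_integrable (h1 i) (h2 i) (h3 i)
          (fun x _ => hφ.differentiable one_ne_zero x)
          (fun x _ => (hξi i).differentiable one_ne_zero x)
    _ = - ∫ x, fderiv ℝ φ x (ξ x) := by
        rw [Finset.sum_neg_distrib, ← integral_finsetSum _ fun i _ => h1 i]
        simp only [sum_apply_single_mul]

/-- Smooth radially decreasing cutoffs, equal to `1` on `B_r` and supported in `B_ε`. -/
lemma exists_radial_cutoff (N : ℕ) {r ε : ℝ} (hr : 0 < r) (hrε : r < ε) :
    ∃ (φ a : EuclideanSpace ℝ (Fin N) → ℝ), ContDiff ℝ 1 φ ∧ (∀ x, 0 ≤ φ x) ∧ (∀ x, φ x ≤ 1) ∧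
      (∀ x, ‖x‖ ≤ r → φ x = 1) ∧ (∀ x, ε ≤ ‖x‖ → φ x = 0) ∧ (∀ x, 0 ≤ a x) ∧
      (∀ x, ‖x‖ < r → a x = 0) ∧ ∀ x v, fderiv ℝ φ x v = - (a x * inner ℝ x v) := by
  have hd : 0 < ε ^ 2 - r ^ 2 := by nlinarith
  set d := ε ^ 2 - r ^ 2 with hd_def
  let q : EuclideanSpace ℝ (Fin N) → ℝ := fun x => (ε ^ 2 - ‖x‖ ^ 2) / d
  have hS : ContDiff ℝ 1 Real.smoothTransition := Real.smoothTransition.contDiff (n := 1)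
  have hq : ContDiff ℝ 1 q := (contDiff_const.sub (contDiff_norm_sq ℝ)).div_const d
  refine ⟨fun x => Real.smoothTransition (q x),
    fun x => deriv Real.smoothTransition (q x) * (2 / d), hS.comp hq,
    fun x => Real.smoothTransition.nonneg _, fun x => Real.smoothTransition.le_one _,
    fun x hx => Real.smoothTransition.one_of_one_le ?_,
    fun x hx => Real.smoothTransition.zero_of_nonpos ?_,
    fun x => mul_nonneg Real.smoothTransition.monotone.deriv_nonneg (by positivity),
    fun x hx => ?_, fun x v => ?_⟩
  · rw [le_div_iff₀ hd]
    nlinarith [norm_nonneg x]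
  · refine div_nonpos_of_nonpos_of_nonneg ?_ hd.le
    nlinarith
  · have h1 : 1 < q x := by
      rw [lt_div_iff₀ hd]
      nlinarith [norm_nonneg x]
    have h2 : Real.smoothTransition =ᶠ[nhds (q x)] fun _ => 1 := by
      filter_upwards [lt_mem_nhds h1] with y hy
      exact Real.smoothTransition.one_of_one_le hy.le
    simp [h2.deriv_eq]
  · have h1 : HasFDerivAt q _ x :=
      HasFDerivAt.congr_of_eventuallyEq
        (((hasStrictFDerivAt_norm_sq x).hasFDerivAt.const_sub (ε ^ 2)).const_mul d⁻¹)
        (Filter.Eventually.of_forall fun y => div_eq_inv_mul _ _)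
    have h2 := ((hS.differentiable one_ne_zero (q x)).hasDerivAt.comp_hasFDerivAt x h1).fderiv
    change fderiv ℝ (Real.smoothTransition ∘ q) x v = _
    rw [h2]
    simp
    ring

/-- The divergence theorem bound for balls. -/
lemma setIntegral_diverg_ball_le {N : ℕ} {ε : ℝ} (hε : 0 < ε)
    {ξ : EuclideanSpace ℝ (Fin N) → EuclideanSpace ℝ (Fin N)} (hξ : ContDiff ℝ 1 ξ)
    (hb : ∀ x, ‖ξ x‖ ≤ 1) :
    ∫ x in Metric.ball (0 : EuclideanSpace ℝ (Fin N)) ε, diverg ξ x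
      ≤ N / ε * volume.real (Metric.ball (0 : EuclideanSpace ℝ (Fin N)) ε) := by
  set B := Metric.ball (0 : EuclideanSpace ℝ (Fin N)) ε with hB
  obtain ⟨r, -, hr, hlim⟩ := exists_seq_strictMono_tendsto' hε
  choose φ a hφ h0 h1 hin hout ha ha0 hfd using
    fun n => exists_radial_cutoff N (hr n).1 (hr n).2
  have hcomp : ∀ n, HasCompactSupport (φ n) := fun n =>
    HasCompactSupport.intro (isCompact_closedBall (0 : EuclideanSpace ℝ (Fin N)) ε) fun x hx =>
      hout n x (by simpa using (not_le.1 (by simpa using hx)).le)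
  have hBfin : volume B ≠ ⊤ := measure_ball_lt_top.ne
  have hset : ∀ n (f : EuclideanSpace ℝ (Fin N) → ℝ),
      ∫ x, φ n x * f x = ∫ x in B, φ n x * f x := fun n f =>
    (setIntegral_eq_integral_of_forall_compl_eq_zero fun x hx => by
      rw [hout n x (by simpa [hB] using hx), zero_mul]).symm
  have hbound : ∀ n, ∫ x in B, φ n x * diverg ξ x ≤ N / r n * volume.real B := by
    intro n
    have hai : ∀ η : EuclideanSpace ℝ (Fin N) → EuclideanSpace ℝ (Fin N), Continuous η →
        Integrable fun x => a n x * inner ℝ x (η x) := by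
      intro η hη
      have hcont : Continuous fun x => fderiv ℝ (φ n) x (η x) :=
        ((hφ n).continuous_fderiv one_ne_zero).clm_apply hη
      have hcs : HasCompactSupport fun x => fderiv ℝ (φ n) x (η x) :=
        ((hcomp n).fderiv ℝ).mono' (fun x hx => subset_closure (by
          intro h
          exact hx (by simp [h])))
      have := (hcont.integrable_of_hasCompactSupport (μ := volume) hcs).neg
      refine this.congr (Filter.Eventually.of_forall fun x => ?_)
      simp [hfd]
    have hid : ∫ x, a n x * inner ℝ x x = N * ∫ x, φ n x := by
      have := integral_mul_diverg (hφ n) (hcomp n)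
        (ξ := fun x => x) contDiff_id
      have hdiv : ∀ x, diverg (fun x : EuclideanSpace ℝ (Fin N) => x) x = N := fun x => by
        simpa using diverg_const_smul_id (1 : ℝ) x
      simp only [hdiv, hfd, integral_neg, neg_neg, integral_mul_const] at this
      rw [← this, mul_comm]
    have hφle : ∫ x, φ n x ≤ volume.real B := by
      have h := hset n fun _ => 1
      simp only [mul_one] at h
      rw [h]
      calc ∫ x in B, φ n x ≤ ∫ x in B, (1 : ℝ) :=
            integral_mono
              (((hφ n).continuous.integrable_of_hasCompactSupport (hcomp n)).integrableOn)
              (integrable_const_iff.2 (Or.inr ⟨by simpa using hBfin.lt_top⟩)) (h1 n)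
        _ = volume.real B := by simp
    calc ∫ x in B, φ n x * diverg ξ x = ∫ x, a n x * inner ℝ x (ξ x) := by
          rw [← hset n, integral_mul_diverg (hφ n) (hcomp n) hξ]
          simp only [hfd, integral_neg, neg_neg]
      _ ≤ ∫ x, (r n)⁻¹ * (a n x * inner ℝ x x) := by
          refine integral_mono (hai ξ hξ.continuous) ((hai _ continuous_id).const_mul _) fun x => ?_
          by_cases hx : ‖x‖ < r n
          · simp [ha0 n x hx]
          · have hin1 : inner ℝ x (ξ x) ≤ ‖x‖ := (real_inner_le_norm _ _).trans
              (mul_le_of_le_one_right (norm_nonneg _) (hb x))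
            have h2 : ‖x‖ ≤ (r n)⁻¹ * (‖x‖ * ‖x‖) := by
              rw [← div_eq_inv_mul, le_div_iff₀ (hr n).1]
              exact mul_le_mul_of_nonneg_left (not_lt.1 hx) (norm_nonneg _)
            simp only [real_inner_self_eq_norm_mul_norm]
            calc a n x * inner ℝ x (ξ x) ≤ a n x * ((r n)⁻¹ * (‖x‖ * ‖x‖)) :=
                  mul_le_mul_of_nonneg_left (hin1.trans h2) (ha n x)
              _ = _ := by ring
      _ = N / r n * ∫ x, φ n x := by rw [integral_const_mul, hid]; ring
      _ ≤ N / r n * volume.real B :=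
          mul_le_mul_of_nonneg_left hφle (div_nonneg (Nat.cast_nonneg _) (hr n).1.le)
  have hL : Filter.Tendsto (fun n => ∫ x in B, φ n x * diverg ξ x) Filter.atTop
      (nhds (∫ x in B, diverg ξ x)) := by
    refine tendsto_integral_of_dominated_convergence (fun x => ‖diverg ξ x‖)
      (fun n => ((hφ n).continuous.mul (diverg_continuous hξ)).aestronglyMeasurable)
      (integrableOn_diverg hξ subset_rfl).norm
      (fun n => Filter.Eventually.of_forall fun x => ?_) ?_
    · rw [norm_mul, Real.norm_of_nonneg (h0 n x)]
      exact mul_le_of_le_one_left (norm_nonneg _) (h1 n x)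
    · filter_upwards [ae_restrict_mem measurableSet_ball] with x hx
      refine tendsto_const_nhds.congr' ?_
      filter_upwards [hlim.eventually (lt_mem_nhds (by simpa [hB] using hx : ‖x‖ < ε))] with n hn
      rw [hin n x hn.le, one_mul]
  exact le_of_tendsto_of_tendsto' hL
    ((tendsto_const_nhds.div hlim hε.ne').mul_const _) hbound

/-- Calibration by perturbations of the field `x / ε`. -/
lemma le_perimeter_of_perturbation {N : ℕ} {ε r : ℝ} (hε : 0 < ε)
    {A : Set (EuclideanSpace ℝ (Fin N))} (hA : A ⊆ Metric.ball 0 ε) (hm : MeasurableSet A)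
    {η : EuclideanSpace ℝ (Fin N) → EuclideanSpace ℝ (Fin N)} (hη : ContDiff ℝ 1 η)
    (hb : ∀ x, ‖η x‖ ≤ 1 - r / ε) (hs : ∀ x, r < ‖x‖ → η x = 0) :
    ENNReal.ofReal (N / ε * volume.real A + ∫ x in A, diverg η x) ≤ perimeter A := by
  have hAfin : volume A ≠ ⊤ := ((measure_mono hA).trans_lt measure_ball_lt_top).ne
  have key : ∀ t ∈ Set.Ioo (0 : ℝ) 1,
      ENNReal.ofReal (N * (t / ε) * volume.real A + ∫ x in A, diverg η x) ≤ perimeter A := by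
    rintro t ⟨ht0, ht1⟩
    let χ : ContDiffBump (0 : EuclideanSpace ℝ (Fin N)) := ⟨ε, ε / t, hε, by
      rw [lt_div_iff₀ ht0]; nlinarith⟩
    let ξ : EuclideanSpace ℝ (Fin N) → EuclideanSpace ℝ (Fin N) :=
      fun x => (t / ε * χ x) • x + η x
    have hξ : ContDiff ℝ 1 ξ := ((contDiff_const.mul χ.contDiff).smul contDiff_id).add hη
    have hle : ∀ x, ‖(t / ε * χ x) • x‖ ≤ t / ε * ‖x‖ := fun x => by
      rw [norm_smul, Real.norm_of_nonneg (mul_nonneg (by positivity) χ.nonneg)]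
      exact mul_le_mul_of_nonneg_right
        (mul_le_of_le_one_right (by positivity) χ.le_one) (norm_nonneg _)
    have hξb : ∀ x, ‖ξ x‖ ≤ 1 := by
      intro x
      rcases le_or_gt ‖x‖ r with hx | hx
      · have h1 : t / ε * ‖x‖ ≤ r / ε := by
          rw [div_mul_eq_mul_div]
          gcongr
          nlinarith [norm_nonneg x]
        linarith [norm_add_le ((t / ε * χ x) • x) (η x), hle x, hb x]
      · simp only [ξ, hs x hx, add_zero]
        rcases le_or_gt (ε / t) ‖x‖ with h2 | h2
        · rw [χ.zero_of_le_dist (by simpa using h2)]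
          simp
        · refine (hle x).trans ?_
          rw [lt_div_iff₀ ht0] at h2
          rw [div_mul_eq_mul_div, div_le_one hε]
          linarith
    have hdiv : ∀ x ∈ A, diverg ξ x = N * (t / ε) + diverg η x := by
      intro x hx
      have : ξ =ᶠ[nhds x] fun y => (t / ε) • y + η y := by
        filter_upwards [χ.eventuallyEq_one_of_mem_ball (hA hx)] with y hy
        simp [ξ, hy]
      rw [diverg_congr this, diverg_add (ξ := fun y => (t / ε) • y)
        (differentiableAt_id.const_smul (t / ε))
        (hη.differentiable one_ne_zero x), diverg_const_smul_id]
    have hint : ∫ x in A, diverg ξ x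
        = N * (t / ε) * volume.real A + ∫ x in A, diverg η x := by
      rw [setIntegral_congr_fun hm hdiv, integral_add
        (integrable_const_iff.2 (Or.inr ⟨by simpa using hAfin.lt_top⟩))
        (integrableOn_diverg hη hA)]
      simp [mul_comm]
    rw [← hint]
    exact le_iSup (fun ξ : {ξ : EuclideanSpace ℝ (Fin N) → EuclideanSpace ℝ (Fin N) //
      ContDiff ℝ 1 ξ ∧ ∀ x, ‖ξ x‖ ≤ 1} => ENNReal.ofReal (∫ x in A, diverg ξ.1 x)) ⟨ξ, hξ, hξb⟩
  have hlim : Filter.Tendsto (fun t : ℝ =>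
      ENNReal.ofReal (N * (t / ε) * volume.real A + ∫ x in A, diverg η x))
      (nhdsWithin 1 (Set.Iio 1))
      (nhds (ENNReal.ofReal (N * (1 / ε) * volume.real A + ∫ x in A, diverg η x))) := by
    refine (Continuous.tendsto ?_ 1).mono_left nhdsWithin_le_nhds
    exact ENNReal.continuous_ofReal.comp (by fun_prop)
  have := le_of_tendsto hlim (Filter.mem_of_superset (Ioo_mem_nhdsLT one_pos) key)
  rwa [mul_one_div] at this

/-- A set whose indicator has vanishing distributional gradient in a ball is null or conull
there. -/
lemma null_or_conull_of_integral_fderiv_eq_zero {N : ℕ} {ε : ℝ}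
    {A : Set (EuclideanSpace ℝ (Fin N))} (hA : A ⊆ Metric.ball 0 ε) (hm : MeasurableSet A)
    (h : ∀ r < ε, ∀ ρ : EuclideanSpace ℝ (Fin N) → ℝ, ContDiff ℝ 1 ρ →
      (∀ x, r < ‖x‖ → ρ x = 0) → ∀ v, ∫ x in A, fderiv ℝ ρ x v = 0) :
    volume A = 0 ∨ volume (Metric.ball (0 : EuclideanSpace ℝ (Fin N)) ε \ A) = 0 := by
  let g : EuclideanSpace ℝ (Fin N) → ℝ := A.indicator 1
  have hAfin : volume A ≠ ⊤ := ((measure_mono hA).trans_lt measure_ball_lt_top).ne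
  have hg : LocallyIntegrable g volume :=
    ((integrable_indicator_iff hm).2
      (integrableOn_const hAfin)).locallyIntegrable
  let φ : ℕ → ContDiffBump (0 : EuclideanSpace ℝ (Fin N)) := fun n =>
    ⟨1 / ((n : ℝ) + 1) / 2, 1 / ((n : ℝ) + 1), by positivity, half_lt_self (by positivity)⟩
  have hφ0 : Filter.Tendsto (fun n => (φ n).rOut) Filter.atTop (nhds 0) :=
    tendsto_one_div_add_atTop_nhds_zero_nat
  let u : ℕ → EuclideanSpace ℝ (Fin N) → ℝ := fun n =>
    convolution ((φ n).normed volume) g (ContinuousLinearMap.lsmul ℝ ℝ) volume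
  have hae : ∀ᵐ x, Filter.Tendsto (fun n => u n x) Filter.atTop (nhds (g x)) :=
    ContDiffBump.ae_convolution_tendsto_right_of_locallyIntegrable hφ0 (K := 2)
      (Filter.Eventually.of_forall fun n => by simp only [φ]; linarith) hg
  have hder : ∀ n x, ‖x‖ + (φ n).rOut < ε → HasFDerivAt (u n)
      (0 : EuclideanSpace ℝ (Fin N) →L[ℝ] ℝ) x := by
    intro n x hx
    have hsm : ContDiff ℝ 1 ((φ n).normed (volume : Measure (EuclideanSpace ℝ (Fin N)))) :=
      (φ n).contDiff_normed (n := 1)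
    have hcs := (φ n).hasCompactSupport_normed (μ := volume)
    have hD := hcs.hasFDerivAt_convolution_left (ContinuousLinearMap.lsmul ℝ ℝ) hsm hg x
    refine hD.congr_fderiv (ContinuousLinearMap.ext fun v => ?_)
    have hex := (hcs.fderiv ℝ).convolutionExists_left
      ((ContinuousLinearMap.lsmul ℝ ℝ).precompL (EuclideanSpace ℝ (Fin N)))
      (hsm.continuous_fderiv one_ne_zero) hg x
    have hρ : ∀ y, HasFDerivAt (fun y => (φ n).normed volume (x - y))
        (-(fderiv ℝ ((φ n).normed volume) (x - y))) y := by
      intro y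
      have := (hsm.differentiable one_ne_zero (x - y)).hasFDerivAt.comp y
        ((hasFDerivAt_id y).const_sub x)
      refine this.congr_fderiv ?_
      ext; simp
    have h0 := h _ hx (fun y => (φ n).normed volume (x - y))
      (hsm.comp (contDiff_const.sub contDiff_id)) (fun y hy => by
        have : x - y ∉ Function.support ((φ n).normed volume) := by
          rw [(φ n).support_normed_eq, mem_ball_zero_iff, not_lt]
          linarith [norm_sub_norm_le y x, norm_sub_rev x y]
        simpa using this) v
    simp only [(hρ _).fderiv] at h0
    rw [convolution_eq_swap, ContinuousLinearMap.integral_apply hex.integrable_swap]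
    simp only [ContinuousLinearMap.precompL_apply, ContinuousLinearMap.lsmul_apply,
      zero_apply]
    rw [← integral_indicator hm] at h0
    rw [← neg_eq_zero, ← integral_neg, ← h0]
    refine integral_congr_ae (Filter.Eventually.of_forall fun y => ?_)
    by_cases hy : y ∈ A <;> simp [g, hy]
  have hconst : ∀ x ∈ Metric.ball (0 : EuclideanSpace ℝ (Fin N)) ε,
      ∀ᶠ n in Filter.atTop, u n x = u n 0 := by
    intro x hx
    rw [mem_ball_zero_iff] at hx
    filter_upwards [hφ0.eventually (gt_mem_nhds (sub_pos.2 hx))] with n hn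
    have hd : ∀ y ∈ Metric.ball (0 : EuclideanSpace ℝ (Fin N)) (ε - (φ n).rOut),
        HasFDerivAt (u n) 0 y := fun y hy => hder n y (by
      rw [mem_ball_zero_iff] at hy; linarith)
    refine Metric.isOpen_ball.is_const_of_fderiv_eq_zero
      (convex_ball (0 : EuclideanSpace ℝ (Fin N)) _).isPreconnected
      (fun y hy => (hd y hy).differentiableAt.differentiableWithinAt)
      (fun y hy => (hd y hy).fderiv) (by rw [mem_ball_zero_iff]; linarith) ?_
    rw [mem_ball_zero_iff, norm_zero]
    linarith [norm_nonneg x]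
  by_contra! hne
  obtain ⟨x, hxA, hx⟩ := ((frequently_ae_mem_iff.2 hne.1).and_eventually hae).exists
  obtain ⟨y, hyB, hy⟩ := ((frequently_ae_mem_iff.2 hne.2).and_eventually hae).exists
  have h1 := hx.congr' (hconst x (hA hxA))
  have h2 := hy.congr' (hconst y hyB.1)
  have := tendsto_nhds_unique h1 h2
  simp [g, hxA, hyB.2] at this

lemma ofReal_mul_volume_le_perimeter {N : ℕ} {ε : ℝ} (hε : 0 < ε)
    {A : Set (EuclideanSpace ℝ (Fin N))} (hA : A ⊆ Metric.ball 0 ε) (hm : MeasurableSet A) :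
    ENNReal.ofReal (N / ε) * volume A ≤ perimeter A := by
  have hAfin : volume A ≠ ⊤ := ((measure_mono hA).trans_lt measure_ball_lt_top).ne
  have h := le_perimeter_of_perturbation (r := 0) hε hA hm
    (contDiff_const (c := (0 : EuclideanSpace ℝ (Fin N)))) (by simp) (by simp)
  have h0 : ∀ x, diverg (fun _ : EuclideanSpace ℝ (Fin N) => (0 : EuclideanSpace ℝ (Fin N))) x
      = 0 := fun x => by simp [diverg]
  simp only [h0, integral_zero, add_zero] at h
  rwa [ENNReal.ofReal_mul (by positivity), ofReal_measureReal hAfin] at h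

lemma perimeter_ball {N : ℕ} {ε : ℝ} (hε : 0 < ε) :
    perimeter (Metric.ball (0 : EuclideanSpace ℝ (Fin N)) ε)
      = ENNReal.ofReal (N / ε) * volume (Metric.ball (0 : EuclideanSpace ℝ (Fin N)) ε) := by
  refine le_antisymm (iSup_le fun ξ => ?_)
    (ofReal_mul_volume_le_perimeter hε subset_rfl measurableSet_ball)
  rw [← ofReal_measureReal (measure_ball_lt_top (μ := volume)).ne,
    ← ENNReal.ofReal_mul (by positivity)]
  exact ENNReal.ofReal_le_ofReal (setIntegral_diverg_ball_le hε ξ.2.1 ξ.2.2)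

lemma perimeter_congr {N : ℕ} {A B : Set (EuclideanSpace ℝ (Fin N))} (h : A =ᵐ[volume] B) :
    perimeter A = perimeter B := by
  simp only [perimeter, setIntegral_congr_set h]

/-- If the lower perimeter bound is attained by `A`, the indicator of `A` has vanishing
distributional gradient in the ball. -/
lemma setIntegral_fderiv_eq_zero {N : ℕ} {ε : ℝ} (hε : 0 < ε)
    {A : Set (EuclideanSpace ℝ (Fin N))} (hA : A ⊆ Metric.ball 0 ε) (hm : MeasurableSet A)
    (hP : perimeter A = ENNReal.ofReal (N / ε) * volume A) {r : ℝ} (hr : r < ε)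
    {ρ : EuclideanSpace ℝ (Fin N) → ℝ} (hρ : ContDiff ℝ 1 ρ) (hs : ∀ x, r < ‖x‖ → ρ x = 0)
    (v : EuclideanSpace ℝ (Fin N)) : ∫ x in A, fderiv ℝ ρ x v = 0 := by
  have hAfin : volume A ≠ ⊤ := ((measure_mono hA).trans_lt measure_ball_lt_top).ne
  have hcs : HasCompactSupport ρ :=
    HasCompactSupport.intro (isCompact_closedBall (0 : EuclideanSpace ℝ (Fin N)) r) fun x hx =>
      hs x (by simpa using hx)
  obtain ⟨M, hM⟩ := hcs.exists_bound_of_continuous hρ.continuous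
  have hM0 : 0 ≤ M := (norm_nonneg _).trans (hM 0)
  have hle : ∀ w : EuclideanSpace ℝ (Fin N), ∫ x in A, fderiv ℝ ρ x w ≤ 0 := by
    intro w
    have hgap : 0 < 1 - r / ε := by
      rw [sub_pos, div_lt_one hε]; exact hr
    set c := (1 - r / ε) / (M * ‖w‖ + 1) with hc
    have hcpos : 0 < c := by positivity
    have h := le_perimeter_of_perturbation (η := fun x => ρ x • (c • w)) hε hA hm
      (hρ.smul contDiff_const) (fun x => by
        rw [norm_smul, norm_smul, Real.norm_of_nonneg hcpos.le]
        calc ‖ρ x‖ * (c * ‖w‖) ≤ M * (c * ‖w‖) := by gcongr; exact hM x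
          _ = c * (M * ‖w‖) := by ring
          _ ≤ c * (M * ‖w‖ + 1) := by gcongr; linarith
          _ = 1 - r / ε := by rw [hc]; field_simp)
      (fun x hx => by simp [hs x hx])
    rw [hP, ← ofReal_measureReal hAfin, ← ENNReal.ofReal_mul (by positivity),
      ENNReal.ofReal_le_ofReal_iff (by positivity)] at h
    simp only [fun x => diverg_smul_const (hρ.differentiable one_ne_zero x) (c • w), map_smul,
      smul_eq_mul, integral_const_mul] at h
    exact nonpos_of_mul_nonpos_right (by linarith) hcpos
  refine le_antisymm (hle v) ?_
  have := hle (-v)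
  simp only [map_neg, integral_neg] at this
  linarith

/-- Model case of Theorem 0: the open ball `B_ε ⊂ ℝ^N` (`N ≥ 2`, `ε > 0`) of radius `ε`
about the origin is uniquely self-Cheeger with Cheeger constant `N/ε`: every measurable
`A ⊆ B_ε` with `vol(A) > 0` satisfies `P(A)/vol(A) ≥ N/ε`, with equality
`P(A) = (N/ε)·vol(A)` if and only if `vol(B_ε \ A) = 0`; and
`h(B_ε) = N/ε`, attained by `A = B_ε`. -/
theorem ball_uniquely_self_cheeger {N : ℕ} (hN : 2 ≤ N) {ε : ℝ} (hε : 0 < ε) :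
    (∀ A : Set (EuclideanSpace ℝ (Fin N)),
      A ⊆ Metric.ball (0 : EuclideanSpace ℝ (Fin N)) ε → MeasurableSet A →
      0 < volume A →
      ENNReal.ofReal ((N : ℝ) / ε) ≤ perimeter A / volume A ∧
      (perimeter A = ENNReal.ofReal ((N : ℝ) / ε) * volume A ↔
        volume (Metric.ball (0 : EuclideanSpace ℝ (Fin N)) ε \ A) = 0)) ∧
    cheegerConstant (Metric.ball (0 : EuclideanSpace ℝ (Fin N)) ε)
      = ENNReal.ofReal ((N : ℝ) / ε) ∧
    perimeter (Metric.ball (0 : EuclideanSpace ℝ (Fin N)) ε)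
        / volume (Metric.ball (0 : EuclideanSpace ℝ (Fin N)) ε)
      = ENNReal.ofReal ((N : ℝ) / ε) := by
  set B := Metric.ball (0 : EuclideanSpace ℝ (Fin N)) ε with hB
  have hBpos : 0 < volume B := Metric.measure_ball_pos volume _ hε
  have hBfin : volume B ≠ ⊤ := measure_ball_lt_top.ne
  have hlow : ∀ A : Set (EuclideanSpace ℝ (Fin N)), A ⊆ B → MeasurableSet A → 0 < volume A →
      ENNReal.ofReal ((N : ℝ) / ε) ≤ perimeter A / volume A := fun A hA hm hpos => by
    rw [ENNReal.le_div_iff_mul_le (Or.inl hpos.ne')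
      (Or.inl ((measure_mono hA).trans_lt hBfin.lt_top).ne)]
    exact ofReal_mul_volume_le_perimeter hε hA hm
  have hBeq : perimeter B / volume B = ENNReal.ofReal ((N : ℝ) / ε) := by
    rw [hB, perimeter_ball hε]
    exact ENNReal.mul_div_cancel_right hBpos.ne' hBfin
  refine ⟨fun A hA hm hpos => ⟨hlow A hA hm hpos, fun hP => ?_, fun hnull => ?_⟩, ?_, hBeq⟩
  · exact (null_or_conull_of_integral_fderiv_eq_zero hA hm fun r hr ρ hρ hs v =>
      setIntegral_fderiv_eq_zero hε hA hm hP hr hρ hs v).resolve_left hpos.ne'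
  · have hAB : A =ᵐ[volume] B := hA.eventuallyLE.antisymm (ae_le_set.2 hnull)
    rw [perimeter_congr hAB, measure_congr hAB, hB, perimeter_ball hε]
  · refine le_antisymm ?_ (le_iInf₂ fun A hA => hlow A hA.1 hA.2.1 hA.2.2.1)
    rw [← hBeq]
    refine iInf₂_le B ⟨subset_rfl, measurableSet_ball, hBpos, ?_⟩
    rw [hB, perimeter_ball hε]
    exact ENNReal.mul_lt_top ENNReal.ofReal_lt_top hBfin.lt_top

end
end
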